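/- arXiv:dg-ga/9503016 — 11 statements merged into one kernel-verified Lean document; each statement's English description precedes it below -/
import Mathlib

section
/- Let k ≥ 1, let q ∈ ℂ[z] be a monic polynomial of degree k, and let p ∈ ℂ[z] have degree less than k. If q divides p² − 1, then there exist monic polynomials r, s ∈ ℂ[z] and polynomials a, b ∈ ℂ[z] such that q = r·s, p = a·r + b·s, and a·r − b·s = 1. In particular p + 1 = 2·a·r, p − 1 = 2·b·s, so r divides p + 1, s divides p − 1, and r and s are coprime. -/
open Polynomial

/-- A monic divisor of a product `f * g` over a field splits into monic divisors of `f` and `g`. -/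
theorem Polynomial.Monic.exists_monic_dvd_and_dvd_of_dvd_mul {K : Type*} [Field K] {q f g : K[X]}
    (hq : q.Monic) (h : q ∣ f * g) :
    ∃ r s : K[X], r.Monic ∧ s.Monic ∧ q = r * s ∧ r ∣ f ∧ s ∣ g := by
  obtain ⟨r, s, hr, hs, rfl⟩ := exists_dvd_and_dvd_of_dvd_mul h
  have hr0 : r ≠ 0 := left_ne_zero_of_mul hq.ne_zero
  have hC : C r.leadingCoeff⁻¹ * C r.leadingCoeff = 1 := by
    rw [← C_mul, inv_mul_cancel₀ (leadingCoeff_ne_zero.mpr hr0), C_1]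
  have hmonic : (r * C r.leadingCoeff⁻¹).Monic := monic_mul_leadingCoeff_inv hr0
  have hfac : r * s = r * C r.leadingCoeff⁻¹ * (C r.leadingCoeff * s) := by
    linear_combination -(r * s) * hC
  refine ⟨_, C r.leadingCoeff * s, hmonic, hmonic.of_mul_monic_left (hfac ▸ hq), hfac, ?_, ?_⟩
  · exact ((IsUnit.of_mul_eq_one _ hC).mul_right_dvd).mpr hr
  · exact ((IsUnit.of_mul_eq_one_right _ hC).mul_left_dvd).mpr hs

/-- Forward half of Proposition 2: if `q` is monic of degree `k ≥ 1`, `p` has degree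
less than `k`, and `q ∣ p² - 1`, then `q = r·s` with `r, s` monic,
`p = a·r + b·s`, `a·r - b·s = 1`, `p + 1 = 2·a·r`, `p - 1 = 2·b·s`,
`r ∣ p + 1`, `s ∣ p - 1`, and `r, s` coprime. -/
theorem inversion_symmetric_rational_map_factorization
    (k : ℕ) (hk : 1 ≤ k) (p q : ℂ[X])
    (hq : q.Monic) (hqdeg : q.natDegree = k)
    (hpdeg : p.degree < (k : WithBot ℕ))
    (hdiv : q ∣ p ^ 2 - 1) :
    ∃ r s a b : ℂ[X],
      r.Monic ∧ s.Monic ∧ q = r * s ∧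
      p = a * r + b * s ∧ a * r - b * s = 1 ∧
      p + 1 = 2 * (a * r) ∧ p - 1 = 2 * (b * s) ∧
      r ∣ (p + 1) ∧ s ∣ (p - 1) ∧ IsCoprime r s := by
  obtain ⟨r, s, hr, hs, hqrs, ⟨u, hu⟩, ⟨v, hv⟩⟩ :=
    hq.exists_monic_dvd_and_dvd_of_dvd_mul (f := p + 1) (g := p - 1)
      (by convert hdiv using 1; ring)
  have half : (2 : ℂ[X]) * C (1 / 2) = 1 := by
    rw [← C_ofNat, ← C_mul]
    norm_num
  have ha : p + 1 = 2 * (C (1 / 2) * u * r) := by linear_combination hu - u * r * half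
  have hb : p - 1 = 2 * (C (1 / 2) * v * s) := by linear_combination hv - v * s * half
  have hab : C (1 / 2) * u * r - C (1 / 2) * v * s = 1 := by
    linear_combination C (1 / 2) * (hb - ha) + (1 - C (1 / 2) * u * r + C (1 / 2) * v * s) * half
  refine ⟨r, s, C (1 / 2) * u, C (1 / 2) * v, hr, hs, hqrs, ?_, hab, ha, hb,
    ⟨u, hu⟩, ⟨v, hv⟩, C (1 / 2) * u, -(C (1 / 2) * v), ?_⟩
  · linear_combination ha + hab
  · linear_combination hab
end

section
/- Let r, s ∈ ℂ[z] be coprime monic polynomials of degrees m and n respectively, with m + n ≥ 1. Then there exists a unique pair of polynomials (a, b) in ℂ[z] with deg a < n and a·r − b·s = 1. Moreover, setting p := a·r + b·s and q := r·s, one has deg p < m + n, p² = 1 + 4·a·b·q, and p is coprime to q. -/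
open Polynomial

/-- Converse half of Proposition 2: given coprime monic polynomials `r, s` of degrees
`m, n` with `m + n ≥ 1`, there is a unique pair `(a, b)` with `deg a < n` and
`a·r - b·s = 1`; moreover, for such a pair, `p := a·r + b·s` and `q := r·s` satisfy
`deg p < m + n`, `p² = 1 + 4·a·b·q`, and `p` is coprime to `q`. -/
theorem coprime_monic_pair_gives_rational_map
    (m n : ℕ) (hmn : 1 ≤ m + n) (r s : ℂ[X])
    (hr : r.Monic) (hs : s.Monic)
    (hrdeg : r.natDegree = m) (hsdeg : s.natDegree = n)
    (hcop : IsCoprime r s) :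
    (∃! ab : ℂ[X] × ℂ[X],
        ab.1.degree < (n : WithBot ℕ) ∧ ab.1 * r - ab.2 * s = 1) ∧
    (∀ a b : ℂ[X], a.degree < (n : WithBot ℕ) → a * r - b * s = 1 →
        (a * r + b * s).degree < ((m + n : ℕ) : WithBot ℕ) ∧
        (a * r + b * s) ^ 2 = 1 + 4 * (a * b * (r * s)) ∧
        IsCoprime (a * r + b * s) (r * s)) := by
  have hs_degree : s.degree = (n : WithBot ℕ) := by
    rw [degree_eq_natDegree hs.ne_zero, hsdeg]
  have hr_degree : r.degree = (m : WithBot ℕ) := by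
    rw [degree_eq_natDegree hr.ne_zero, hrdeg]
  refine ⟨?_, fun a b ha hab => ?_⟩
  · obtain ⟨u, v, huv⟩ := hcop
    refine ⟨(u %ₘ s, -((u /ₘ s) * r + v)), ⟨?_, ?_⟩, ?_⟩
    · exact hs_degree ▸ degree_modByMonic_lt u hs
    · linear_combination huv + r * modByMonic_add_div u s
    · rintro ⟨a, b⟩ ⟨ha, hab⟩
      have hdvd : s ∣ a - u %ₘ s :=
        ⟨u * b + a * v + u /ₘ s, by
          linear_combination u * hab - a * huv - modByMonic_add_div u s⟩
      have hzero : a - u %ₘ s = 0 := by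
        refine eq_zero_of_dvd_of_degree_lt hdvd ((degree_sub_le _ _).trans_lt (max_lt ?_ ?_))
        · exact hs_degree ▸ ha
        · exact degree_modByMonic_lt u hs
      refine Prod.ext (sub_eq_zero.mp hzero) (mul_right_cancel₀ hs.ne_zero ?_)
      linear_combination r * hzero - hab + huv + r * modByMonic_add_div u s
  · have hsq : (a * r + b * s) ^ 2 = 1 + 4 * (a * b * (r * s)) := by
      linear_combination (a * r - b * s + 1) * hab
    refine ⟨?_, hsq, a * r + b * s, -(4 * (a * b)), by linear_combination hsq⟩
    have har : (a * r).degree < ((m + n : ℕ) : WithBot ℕ) := by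
      rw [hr.degree_mul, hr_degree, add_comm m n, Nat.cast_add]
      exact WithBot.add_lt_add_right (WithBot.natCast_ne_bot m) ha
    have hone : (1 : ℂ[X]).degree < ((m + n : ℕ) : WithBot ℕ) := by
      rw [degree_one]
      exact_mod_cast hmn
    have hbs : b * s = a * r - 1 := by linear_combination -hab
    rw [hbs]
    exact (degree_add_le _ _).trans_lt
      (max_lt har ((degree_sub_le _ _).trans_lt (max_lt har hone)))
end

section
/- Let n ≥ 1, let α, β, γ, δ ∈ ℂ, and let ρ₁, ρ₂, ρ₃ and S₁, S₂, S₃ be n×n complex matrices satisfying, for every cyclic permutation (i,j,k) of (1,2,3): [ρ_i, ρ_j] = 2ρ_k, [S_i, ρ_j] + [ρ_i, S_j] = α·ρ_k + β·S_k, and [S_i, S_j] = γ·ρ_k + δ·S_k. Let I ⊆ ℝ be an interval and x, y : I → ℂ differentiable functions satisfying dx/ds = 2x² + αxy + γy² and dy/ds = βxy + δy². Then the matrix-valued functions T_i(s) = x(s)·ρ_i + y(s)·S_i (i = 1,2,3) satisfy Nahm's equations on I. -/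
/-- The commutator of `a • P + b • U` and `a • Q + b • V`, when the brackets of the generators
close on `R` and `W`. -/
theorem commutator_smul_add_smul {K A : Type*} [CommRing K] [Ring A] [Algebra K A]
    {α β γ δ : K} {P Q R U V W : A}
    (hP : P * Q - Q * P = (2 : K) • R)
    (hm : (U * Q - Q * U) + (P * V - V * P) = α • R + β • W)
    (hU : U * V - V * U = γ • R + δ • W) (a b : K) :
    (a • P + b • U) * (a • Q + b • V) - (a • Q + b • V) * (a • P + b • U) =
      (2 * a ^ 2 + α * a * b + γ * b ^ 2) • R + (β * a * b + δ * b ^ 2) • W := by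
  calc
    _ = a ^ 2 • (P * Q - Q * P) + (a * b) • ((U * Q - Q * U) + (P * V - V * P)) +
        b ^ 2 • (U * V - V * U) := by
      simp only [mul_add, add_mul, smul_mul_assoc, mul_smul_comm]
      module
    _ = _ := by
      rw [hP, hm, hU]
      module

/-- Entrywise derivative of a linear combination of two constant matrices. -/
theorem hasDerivAt_smul_add_smul_apply {m n : Type*} {x y : ℝ → ℂ} {x' y' : ℂ} {s : ℝ}
    (hx : HasDerivAt x x' s) (hy : HasDerivAt y y' s) (R W : Matrix m n ℂ) (i : m) (j : n) :
    HasDerivAt (fun t => (x t • R + y t • W) i j) ((x' • R + y' • W) i j) s := by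
  simpa only [Matrix.add_apply, Matrix.smul_apply, smul_eq_mul] using
    (hx.mul_const (R i j)).fun_add (hy.mul_const (W i j))

/-- Reduction of Nahm's equations for G-invariant monopoles: if the matrices
`ρᵢ, Sᵢ` satisfy the cyclic commutation relations `[ρᵢ,ρⱼ] = 2ρₖ`,
`[Sᵢ,ρⱼ] + [ρᵢ,Sⱼ] = α ρₖ + β Sₖ`, `[Sᵢ,Sⱼ] = γ ρₖ + δ Sₖ`, and `x, y`
solve `x' = 2x² + αxy + γy²`, `y' = βxy + δy²` on an interval `I`, then
`Tᵢ(s) = x(s) ρᵢ + y(s) Sᵢ` satisfy Nahm's equations on `I`. -/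
theorem invariant_reduction_solves_nahm
    (n : ℕ) (hn : 1 ≤ n) (α β γ δ : ℂ)
    (ρ₁ ρ₂ ρ₃ S₁ S₂ S₃ : Matrix (Fin n) (Fin n) ℂ)
    (hρ₁ : ρ₁ * ρ₂ - ρ₂ * ρ₁ = (2 : ℂ) • ρ₃)
    (hρ₂ : ρ₂ * ρ₃ - ρ₃ * ρ₂ = (2 : ℂ) • ρ₁)
    (hρ₃ : ρ₃ * ρ₁ - ρ₁ * ρ₃ = (2 : ℂ) • ρ₂)
    (hm₁ : (S₁ * ρ₂ - ρ₂ * S₁) + (ρ₁ * S₂ - S₂ * ρ₁) = α • ρ₃ + β • S₃)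
    (hm₂ : (S₂ * ρ₃ - ρ₃ * S₂) + (ρ₂ * S₃ - S₃ * ρ₂) = α • ρ₁ + β • S₁)
    (hm₃ : (S₃ * ρ₁ - ρ₁ * S₃) + (ρ₃ * S₁ - S₁ * ρ₃) = α • ρ₂ + β • S₂)
    (hS₁ : S₁ * S₂ - S₂ * S₁ = γ • ρ₃ + δ • S₃)
    (hS₂ : S₂ * S₃ - S₃ * S₂ = γ • ρ₁ + δ • S₁)
    (hS₃ : S₃ * S₁ - S₁ * S₃ = γ • ρ₂ + δ • S₂)
    (I : Set ℝ) (hI : Convex ℝ I) (x y : ℝ → ℂ)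
    (hx : ∀ s ∈ I, HasDerivAt x (2 * x s ^ 2 + α * x s * y s + γ * y s ^ 2) s)
    (hy : ∀ s ∈ I, HasDerivAt y (β * x s * y s + δ * y s ^ 2) s)
    (T₁ T₂ T₃ : ℝ → Matrix (Fin n) (Fin n) ℂ)
    (hT₁ : ∀ s, T₁ s = x s • ρ₁ + y s • S₁)
    (hT₂ : ∀ s, T₂ s = x s • ρ₂ + y s • S₂)
    (hT₃ : ∀ s, T₃ s = x s • ρ₃ + y s • S₃) :
    ∀ s ∈ I, ∀ i j : Fin n,
      HasDerivAt (fun t => T₁ t i j) ((T₂ s * T₃ s - T₃ s * T₂ s) i j) s ∧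
      HasDerivAt (fun t => T₂ t i j) ((T₃ s * T₁ s - T₁ s * T₃ s) i j) s ∧
      HasDerivAt (fun t => T₃ t i j) ((T₁ s * T₂ s - T₂ s * T₁ s) i j) s := by
  intro s hs i j
  simp only [hT₁, hT₂, hT₃]
  rw [commutator_smul_add_smul hρ₁ hm₁ hS₁, commutator_smul_add_smul hρ₂ hm₂ hS₂,
    commutator_smul_add_smul hρ₃ hm₃ hS₃]
  exact ⟨hasDerivAt_smul_add_smul_apply (hx s hs) (hy s hs) ρ₁ S₁ i j,
    hasDerivAt_smul_add_smul_apply (hx s hs) (hy s hs) ρ₂ S₂ i j,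
    hasDerivAt_smul_add_smul_apply (hx s hs) (hy s hs) ρ₃ S₃ i j⟩
end

section
/- Let ρ₁, ρ₂, ρ₃ and S₁, S₂, S₃ be the 3×3 complex matrices ρ₁ = [[0,0,0],[0,0,−2],[0,2,0]], ρ₂ = [[0,0,2],[0,0,0],[−2,0,0]], ρ₃ = [[0,−2,0],[2,0,0],[0,0,0]], S₁ = [[0,0,0],[0,0,−1/2],[0,−1/2,0]], S₂ = [[0,0,−1/2],[0,0,0],[−1/2,0,0]], S₃ = [[0,−1/2,0],[−1/2,0,0],[0,0,0]]. For x, y ∈ ℂ set T_i = x·ρ_i + y·S_i. Then for all x, y, η, ζ ∈ ℂ: det(η·I₃ + i(T₁ + iT₂) − 2iζ·T₃ − iζ²·(T₁ − iT₂)) = η³ − (1/2)·(48x² + y²)·y·ζ·(ζ⁴ − 1). -/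
noncomputable def tetRho₁ : Matrix (Fin 3) (Fin 3) ℂ :=
  !![0, 0, 0; 0, 0, -2; 0, 2, 0]
noncomputable def tetRho₂ : Matrix (Fin 3) (Fin 3) ℂ :=
  !![0, 0, 2; 0, 0, 0; -2, 0, 0]
noncomputable def tetRho₃ : Matrix (Fin 3) (Fin 3) ℂ :=
  !![0, -2, 0; 2, 0, 0; 0, 0, 0]
noncomputable def tetS₁ : Matrix (Fin 3) (Fin 3) ℂ :=
  !![0, 0, 0; 0, 0, -1/2; 0, -1/2, 0]
noncomputable def tetS₂ : Matrix (Fin 3) (Fin 3) ℂ :=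
  !![0, 0, -1/2; 0, 0, 0; -1/2, 0, 0]
noncomputable def tetS₃ : Matrix (Fin 3) (Fin 3) ℂ :=
  !![0, -1/2, 0; -1/2, 0, 0; 0, 0, 0]

noncomputable def tetT (x y : ℂ) : Fin 3 → Matrix (Fin 3) (Fin 3) ℂ
  | 0 => x • tetRho₁ + y • tetS₁
  | 1 => x • tetRho₂ + y • tetS₂
  | 2 => x • tetRho₃ + y • tetS₃

/-- The spectral polynomial of the tetrahedral Nahm matrices `Tᵢ = x ρᵢ + y Sᵢ`:
`det(η + i(T₁+iT₂) - 2iζT₃ - iζ²(T₁-iT₂)) = η³ - (1/2)(48x² + y²)y ζ(ζ⁴-1)`. -/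
theorem tetrahedral_spectral_polynomial (x y η ζ : ℂ) :
    Matrix.det
      (η • (1 : Matrix (Fin 3) (Fin 3) ℂ)
        + Complex.I • (tetT x y 0 + Complex.I • tetT x y 1)
        - (2 * Complex.I * ζ) • tetT x y 2
        - (Complex.I * ζ ^ 2) • (tetT x y 0 - Complex.I • tetT x y 1))
      = η ^ 3 - (1/2) * (48 * x ^ 2 + y ^ 2) * y * ζ * (ζ ^ 4 - 1) := by
  rw [Matrix.det_fin_three]
  simp only [tetT, tetRho₁, tetRho₂, tetRho₃, tetS₁, tetS₂, tetS₃, Matrix.sub_apply,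
    Matrix.add_apply, Matrix.smul_apply, smul_eq_mul]
  simp
  grind [Complex.I_sq]
end

section
/- Let I ⊆ ℝ be an interval and let x, y : I → ℂ be differentiable functions satisfying dx/ds = 2x² + y²/8 and dy/ds = −4xy on I. Then the function s ↦ (48·x(s)² + y(s)²)·y(s) is constant on I. -/
/-- Conservation law for the reduced Nahm system of the tetrahedrally symmetric
charge 3 monopole: if `x' = 2x² + y²/8` and `y' = -4xy` on an interval `I`,
then `(48x² + y²)·y` is constant on `I`. -/
theorem tetrahedral_nahm_conserved_quantity
    (I : Set ℝ) (hI : Convex ℝ I) (x y : ℝ → ℂ)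
    (hx : ∀ s ∈ I, HasDerivAt x (2 * x s ^ 2 + y s ^ 2 / 8) s)
    (hy : ∀ s ∈ I, HasDerivAt y (-4 * x s * y s) s) :
    ∀ s ∈ I, ∀ t ∈ I,
      (48 * x s ^ 2 + y s ^ 2) * y s = (48 * x t ^ 2 + y t ^ 2) * y t := by
  have hderiv : ∀ s ∈ I,
      HasDerivWithinAt (fun s => (48 * x s ^ 2 + y s ^ 2) * y s) 0 I s := by
    intro s hs
    have h := ((((hx s hs).fun_pow 2).const_mul 48).fun_add ((hy s hs).fun_pow 2)).fun_mul (hy s hs)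
    refine (h.congr_deriv ?_).hasDerivWithinAt
    push_cast
    ring
  intro s hs t ht
  have h := hI.norm_image_sub_le_of_norm_hasDerivWithin_le (C := 0) hderiv (by simp) ht hs
  rw [zero_mul] at h
  exact sub_eq_zero.mp (norm_le_zero_iff.mp h)
end

section
/- Let d ∈ ℂ, let I ⊆ ℝ be an interval, and let φ : I → ℂ be a twice differentiable nowhere-vanishing function satisfying (dφ/ds)² = (d²/3)·(φ³ + 1) and d²φ/ds² = (d²/2)·φ² on I. Define x = φ′/(4φ) and y = i·d/φ. Then dx/ds = 2x² + y²/8 and dy/ds = −4xy on I. -/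
/-- Elliptic-function solution of the reduced tetrahedral Nahm system: if `φ` is
twice differentiable and nowhere vanishing on an interval `I` with
`φ'² = (d²/3)(φ³ + 1)` and `φ'' = (d²/2)φ²`, then `x = φ'/(4φ)` and `y = i·d/φ`
satisfy `x' = 2x² + y²/8` and `y' = -4xy` on `I`. -/
theorem tetrahedral_nahm_elliptic_solution
    (d : ℂ) (I : Set ℝ) (hI : Convex ℝ I)
    (φ φ' φ'' : ℝ → ℂ)
    (hderiv : ∀ s ∈ I, HasDerivAt φ (φ' s) s)
    (hderiv' : ∀ s ∈ I, HasDerivAt φ' (φ'' s) s)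
    (hne : ∀ s ∈ I, φ s ≠ 0)
    (hode1 : ∀ s ∈ I, φ' s ^ 2 = d ^ 2 / 3 * (φ s ^ 3 + 1))
    (hode2 : ∀ s ∈ I, φ'' s = d ^ 2 / 2 * φ s ^ 2)
    (x y : ℝ → ℂ)
    (hxdef : ∀ s, x s = φ' s / (4 * φ s))
    (hydef : ∀ s, y s = Complex.I * d / φ s) :
    ∀ s ∈ I,
      HasDerivAt x (2 * x s ^ 2 + y s ^ 2 / 8) s ∧
      HasDerivAt y (-4 * x s * y s) s := by
  intro s hs
  have h0 := hne s hs
  obtain rfl : x = fun s => φ' s / (4 * φ s) := funext hxdef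
  obtain rfl : y = fun s => Complex.I * d / φ s := funext hydef
  constructor
  · refine ((hderiv' s hs).fun_div ((hderiv s hs).const_mul 4)
      (mul_ne_zero (by norm_num) h0)).congr_deriv ?_
    rw [hode2 s hs]
    field_simp
    rw [Complex.I_sq]
    linear_combination -96 * hode1 s hs
  · refine ((hasDerivAt_const s (Complex.I * d)).fun_div (hderiv s hs) h0).congr_deriv ?_
    field_simp
    ring
end

section
/- Let ρ₁, ρ₂, ρ₃ and S₁, S₂, S₃ be the 4×4 complex matrices ρ₁ = [[0,3,0,0],[−1,0,4,0],[0,−1,0,3],[0,0,−1,0]], ρ₂ = i·[[0,3,0,0],[1,0,4,0],[0,1,0,3],[0,0,1,0]], ρ₃ = i·diag(3,1,−1,−3), S₁ = [[0,−6,0,−60],[2,0,12,0],[0,−3,0,−6],[5/3,0,2,0]], S₂ = i·[[0,−6,0,60],[−2,0,12,0],[0,3,0,−6],[5/3,0,−2,0]], S₃ = 4i·diag(1,−3,3,−1). For x, y ∈ ℂ set T_i = x·ρ_i + y·S_i. Then for all x, y, η, ζ ∈ ℂ: det(η·I₄ + i(T₁ + iT₂) − 2iζ·T₃ − iζ²·(T₁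 − iT₂)) = η⁴ − 960·y·(x + 3y)·(x − 2y)²·(ζ⁸ + 14ζ⁴ + 1). -/
noncomputable def octRho₁ : Matrix (Fin 4) (Fin 4) ℂ :=
  !![0, 3, 0, 0; -1, 0, 4, 0; 0, -1, 0, 3; 0, 0, -1, 0]
noncomputable def octRho₂ : Matrix (Fin 4) (Fin 4) ℂ :=
  Complex.I • !![0, 3, 0, 0; 1, 0, 4, 0; 0, 1, 0, 3; 0, 0, 1, 0]
noncomputable def octRho₃ : Matrix (Fin 4) (Fin 4) ℂ :=
  Complex.I • !![3, 0, 0, 0; 0, 1, 0, 0; 0, 0, -1, 0; 0, 0, 0, -3]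
noncomputable def octS₁ : Matrix (Fin 4) (Fin 4) ℂ :=
  !![0, -6, 0, -60; 2, 0, 12, 0; 0, -3, 0, -6; 5/3, 0, 2, 0]
noncomputable def octS₂ : Matrix (Fin 4) (Fin 4) ℂ :=
  Complex.I • !![0, -6, 0, 60; -2, 0, 12, 0; 0, 3, 0, -6; 5/3, 0, -2, 0]
noncomputable def octS₃ : Matrix (Fin 4) (Fin 4) ℂ :=
  (4 * Complex.I) • !![1, 0, 0, 0; 0, -3, 0, 0; 0, 0, 3, 0; 0, 0, 0, -1]

noncomputable def octT (x y : ℂ) : Fin 3 → Matrix (Fin 4) (Fin 4) ℂ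
  | 0 => x • octRho₁ + y • octS₁
  | 1 => x • octRho₂ + y • octS₂
  | 2 => x • octRho₃ + y • octS₃

/-- The spectral polynomial of the octahedral Nahm matrices `Tᵢ = x ρᵢ + y Sᵢ`:
`det(η + i(T₁+iT₂) - 2iζT₃ - iζ²(T₁-iT₂)) = η⁴ - 960y(x+3y)(x-2y)²(ζ⁸+14ζ⁴+1)`. -/
theorem octahedral_spectral_polynomial (x y η ζ : ℂ) :
    Matrix.det
      (η • (1 : Matrix (Fin 4) (Fin 4) ℂ)
        + Complex.I • (octT x y 0 + Complex.I • octT x y 1)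
        - (2 * Complex.I * ζ) • octT x y 2
        - (Complex.I * ζ ^ 2) • (octT x y 0 - Complex.I • octT x y 1))
      = η ^ 4 - 960 * y * (x + 3 * y) * (x - 2 * y) ^ 2 * (ζ ^ 8 + 14 * ζ ^ 4 + 1) := by
  have entries :
      η • (1 : Matrix (Fin 4) (Fin 4) ℂ)
        + Complex.I • (octT x y 0 + Complex.I • octT x y 1)
        - (2 * Complex.I * ζ) • octT x y 2
        - (Complex.I * ζ ^ 2) • (octT x y 0 - Complex.I • octT x y 1)
      = !![η + ζ * (6 * x + 8 * y), -6 * Complex.I * ζ ^ 2 * (x - 2 * y), 0, -120 * Complex.I * y;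
          -2 * Complex.I * (x - 2 * y), η + ζ * (2 * x - 24 * y),
            -8 * Complex.I * ζ ^ 2 * (x + 3 * y), 0;
          0, -2 * Complex.I * (x + 3 * y), η - ζ * (2 * x - 24 * y),
            -6 * Complex.I * ζ ^ 2 * (x - 2 * y);
          -(10 / 3) * Complex.I * ζ ^ 2 * y, 0, -2 * Complex.I * (x - 2 * y),
            η - ζ * (6 * x + 8 * y)] := by
    ext i j
    fin_cases i <;> fin_cases j <;>
      simp [octT, octRho₁, octRho₂, octRho₃, octS₁, octS₂, octS₃] <;>
      ring_nf <;> simp only [Complex.I_sq, Complex.I_pow_three] <;> ring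
  rw [entries]
  simp [Matrix.det_succ_row_zero, Fin.sum_univ_succ, Fin.succAbove]
  ring_nf
  simp only [Complex.I_sq, Complex.I_pow_four]
  ring
end

section
/- Let I ⊆ ℝ be an interval and let x, y : I → ℂ be differentiable functions satisfying dx/ds = 2x² − 48y² and dy/ds = −6xy − 8y² on I. Then the function s ↦ y(s)·(x(s) + 3y(s))·(x(s) − 2y(s))² is constant on I. -/
/-- Conservation law for the reduced Nahm system of the octahedrally symmetric
charge 4 monopole: if `x' = 2x² - 48y²` and `y' = -6xy - 8y²` on an interval `I`,
then `y·(x + 3y)·(x - 2y)²` is constant on `I`. -/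
theorem octahedral_nahm_conserved_quantity
    (I : Set ℝ) (hI : Convex ℝ I) (x y : ℝ → ℂ)
    (hx : ∀ s ∈ I, HasDerivAt x (2 * x s ^ 2 - 48 * y s ^ 2) s)
    (hy : ∀ s ∈ I, HasDerivAt y (-6 * x s * y s - 8 * y s ^ 2) s) :
    ∀ s ∈ I, ∀ t ∈ I,
      y s * (x s + 3 * y s) * (x s - 2 * y s) ^ 2
        = y t * (x t + 3 * y t) * (x t - 2 * y t) ^ 2 := by
  intro s hs t ht
  have hderiv : ∀ u ∈ I, HasDerivWithinAt
      (fun u => y u * (x u + 3 * y u) * (x u - 2 * y u) ^ 2) 0 I u := by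
    intro u hu
    have h := (((hy u hu).mul ((hx u hu).add ((hy u hu).const_mul 3))).mul
      (((hx u hu).sub ((hy u hu).const_mul 2)).pow 2))
    refine (h.congr_deriv ?_).hasDerivWithinAt
    simp only [Pi.add_apply, Pi.sub_apply, Pi.mul_apply, Pi.pow_apply]
    push_cast
    ring
  have h := hI.norm_image_sub_le_of_norm_hasDerivWithin_le (C := 0) hderiv (by simp) ht hs
  rw [zero_mul] at h
  exact sub_eq_zero.mp (norm_le_zero_iff.mp h)
end

section
/- Let e ∈ ℂ, let I ⊆ ℝ be an interval, and let ψ : I → ℂ be a twice differentiable function with dψ/ds nowhere vanishing, satisfying (dψ/ds)² = 16e²·(ψ³ − ψ) and d²ψ/ds² = 8e²·(3ψ² − 1) on I. Define x = (4e²/5)·(5ψ² − 3)/ψ′ and y = (4e²/5)/ψ′, where ψ′ = dψ/ds. Then dx/ds = 2x² − 48y² and dy/ds = −6xy − 8y² on I. -/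
/-- Elliptic-function solution of the reduced octahedral Nahm system: if `ψ` is
twice differentiable with nowhere-vanishing derivative on an interval `I`, with
`ψ'² = 16e²(ψ³ - ψ)` and `ψ'' = 8e²(3ψ² - 1)`, then `x = (4e²/5)(5ψ² - 3)/ψ'`
and `y = (4e²/5)/ψ'` satisfy `x' = 2x² - 48y²` and `y' = -6xy - 8y²` on `I`. -/
theorem octahedral_nahm_elliptic_solution
    (e : ℂ) (I : Set ℝ) (hI : Convex ℝ I)
    (ψ ψ' ψ'' : ℝ → ℂ)
    (hderiv : ∀ s ∈ I, HasDerivAt ψ (ψ' s) s)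
    (hderiv' : ∀ s ∈ I, HasDerivAt ψ' (ψ'' s) s)
    (hne : ∀ s ∈ I, ψ' s ≠ 0)
    (hode1 : ∀ s ∈ I, ψ' s ^ 2 = 16 * e ^ 2 * (ψ s ^ 3 - ψ s))
    (hode2 : ∀ s ∈ I, ψ'' s = 8 * e ^ 2 * (3 * ψ s ^ 2 - 1))
    (x y : ℝ → ℂ)
    (hxdef : ∀ s, x s = (4 * e ^ 2 / 5) * (5 * ψ s ^ 2 - 3) / ψ' s)
    (hydef : ∀ s, y s = (4 * e ^ 2 / 5) / ψ' s) :
    ∀ s ∈ I,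
      HasDerivAt x (2 * x s ^ 2 - 48 * y s ^ 2) s ∧
      HasDerivAt y (-6 * x s * y s - 8 * y s ^ 2) s := by
  intro s hs
  obtain rfl : x = fun t => (4 * e ^ 2 / 5) * (5 * ψ t ^ 2 - 3) / ψ' t := funext hxdef
  obtain rfl : y = fun t => (4 * e ^ 2 / 5) / ψ' t := funext hydef
  have hψ' := hne s hs
  constructor
  · refine (((((hderiv s hs).pow 2).const_mul 5).sub_const 3).const_mul (4 * e ^ 2 / 5)
      |>.div (hderiv' s hs) hψ').congr_deriv ?_
    simp only [Pi.pow_apply, hode2 s hs]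
    field_simp
    linear_combination 50 * e ^ 2 * ψ s * hode1 s hs
  · refine ((hasDerivAt_const s (4 * e ^ 2 / 5)).div (hderiv' s hs) hψ').congr_deriv ?_
    simp only [hode2 s hs]
    field_simp
    ring
end

section
/- Let I ⊆ ℝ be an interval and let x, z : I → ℂ be differentiable functions satisfying dx/ds = 2x² − z² and dz/ds = −10xz + z² on I. Then the function s ↦ z(s)·(z(s) − 3x(s))²·(z(s) + 4x(s))³ is constant on I. -/
/-- Conservation law for the reduced Nahm system arising in the analysis of
icosahedrally symmetric charge 6 monopoles: if `x' = 2x² - z²` and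
`z' = -10xz + z²` on an interval `I`, then `z·(z - 3x)²·(z + 4x)³` is
constant on `I`. -/
theorem icosahedral_nahm_conserved_quantity
    (I : Set ℝ) (hI : Convex ℝ I) (x z : ℝ → ℂ)
    (hx : ∀ s ∈ I, HasDerivAt x (2 * x s ^ 2 - z s ^ 2) s)
    (hz : ∀ s ∈ I, HasDerivAt z (-10 * x s * z s + z s ^ 2) s) :
    ∀ s ∈ I, ∀ t ∈ I,
      z s * (z s - 3 * x s) ^ 2 * (z s + 4 * x s) ^ 3
        = z t * (z t - 3 * x t) ^ 2 * (z t + 4 * x t) ^ 3 := by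
  have hderiv : ∀ s ∈ I, HasDerivWithinAt
      (fun s => z s * (z s - 3 * x s) ^ 2 * (z s + 4 * x s) ^ 3) 0 I s := by
    intro s hs
    have hu := (hz s hs).fun_sub ((hx s hs).const_mul 3)
    have hv := (hz s hs).fun_add ((hx s hs).const_mul 4)
    have h := ((hz s hs).fun_mul (hu.fun_pow 2)).fun_mul (hv.fun_pow 3)
    refine (h.congr_deriv ?_).hasDerivWithinAt
    push_cast
    ring
  intro s hs t ht
  have hbound := hI.norm_image_sub_le_of_norm_hasDerivWithin_le (C := 0) hderiv
    (fun _ _ => norm_zero.le) ht hs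
  rw [zero_mul] at hbound
  exact sub_eq_zero.mp (norm_le_zero_iff.mp hbound)
end

section
/- Let κ ∈ ℂ, let I ⊆ ℝ be an interval, and let φ : I → ℂ be a twice differentiable function with both φ and dφ/ds nowhere vanishing, satisfying (dφ/ds)² = −(49κ²/9)·(φ³ − 1) and d²φ/ds² = −(49κ²/6)·φ² on I. Define x = φ′/(7φ) − (7κ²/12)·φ²/φ′ and z = (7κ²/3)/(φ·φ′), where φ′ = dφ/ds. Then dx/ds = 2x² − z² and dz/ds = −10xz + z² on I. -/
/-- Elliptic-function solution of the reduced icosahedral Nahm system: if `φ` is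
twice differentiable with `φ` and `φ'` nowhere vanishing on an interval `I`, with
`φ'² = -(49κ²/9)(φ³ - 1)` and `φ'' = -(49κ²/6)φ²`, then
`x = φ'/(7φ) - (7κ²/12)φ²/φ'` and `z = (7κ²/3)/(φ·φ')` satisfy
`x' = 2x² - z²` and `z' = -10xz + z²` on `I`. -/
theorem icosahedral_nahm_elliptic_solution
    (κ : ℂ) (I : Set ℝ) (hI : Convex ℝ I)
    (φ φ' φ'' : ℝ → ℂ)
    (hderiv : ∀ s ∈ I, HasDerivAt φ (φ' s) s)
    (hderiv' : ∀ s ∈ I, HasDerivAt φ' (φ'' s) s)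
    (hφne : ∀ s ∈ I, φ s ≠ 0)
    (hφ'ne : ∀ s ∈ I, φ' s ≠ 0)
    (hode1 : ∀ s ∈ I, φ' s ^ 2 = -(49 * κ ^ 2 / 9) * (φ s ^ 3 - 1))
    (hode2 : ∀ s ∈ I, φ'' s = -(49 * κ ^ 2 / 6) * φ s ^ 2)
    (x z : ℝ → ℂ)
    (hxdef : ∀ s, x s = φ' s / (7 * φ s) - (7 * κ ^ 2 / 12) * φ s ^ 2 / φ' s)
    (hzdef : ∀ s, z s = (7 * κ ^ 2 / 3) / (φ s * φ' s)) :
    ∀ s ∈ I,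
      HasDerivAt x (2 * x s ^ 2 - z s ^ 2) s ∧
      HasDerivAt z (-10 * x s * z s + z s ^ 2) s := by
  intro s hs
  have hp := hφne s hs
  have hq := hφ'ne s hs
  have hode := hode1 s hs
  have hd := hderiv s hs
  have hd' := hderiv' s hs
  rw [hode2 s hs] at hd'
  obtain rfl : x = fun s => φ' s / (7 * φ s) - (7 * κ ^ 2 / 12) * φ s ^ 2 / φ' s := funext hxdef
  obtain rfl : z = fun s => (7 * κ ^ 2 / 3) / (φ s * φ' s) := funext hzdef
  constructor
  · refine ((hd'.fun_div (hd.const_mul 7) (mul_ne_zero (by norm_num) hp)).fun_sub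
      (((hd.fun_pow 2).const_mul (7 * κ ^ 2 / 12)).fun_div hd' hq)).congr_deriv ?_
    rw [← sub_eq_zero]
    have key : -2 * κ ^ 2 * φ s ^ 3 * φ' s ^ 2 - 9 / 49 * φ' s ^ 4 - 49 / 9 * κ ^ 4 * φ s ^ 6
        + 49 / 9 * κ ^ 4 = 0 := by
      linear_combination (-2 * κ ^ 2 * φ s ^ 3
        - 9 / 49 * (φ' s ^ 2 - 49 * κ ^ 2 / 9 * (φ s ^ 3 - 1))) * hode
    rw [← zero_div (φ s ^ 2 * φ' s ^ 2), ← key]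
    field_simp
    push_cast
    ring
  · refine ((hasDerivAt_const s (7 * κ ^ 2 / 3)).fun_div (hd.fun_mul hd')
      (mul_ne_zero hp hq)).congr_deriv ?_
    rw [← sub_eq_zero, zero_mul, zero_sub]
    have key : 3 / 7 * φ' s ^ 2 + 7 / 3 * κ ^ 2 * (φ s ^ 3 - 1) = 0 := by
      linear_combination 3 / 7 * hode
    rw [← mul_zero (7 * κ ^ 2 / 3 / (φ s ^ 2 * φ' s ^ 2)), ← key]
    field_simp
    ring
end
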